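/- For every ε > 0 there exists a finite constant C such that for every integer h ≥ 1 and every integer k lying in the interval [(h − h^{1/2+ε})/2, (h + h^{1/2+ε})/2], if the chain Y starts at k then P(σ̃_h = ∞) < C·h^{−1/2+ε}. -/

import Mathlib

open MeasureTheory ProbabilityTheory
open scoped ENNReal

/-- π(0,j) := δ_{0,j} and, for i > 0, π(i,j) := 2^{−i−j}·(i+j−1)!/((i−1)!·j!). -/
noncomputable def piGW (i j : ℕ) : ℝ :=
  if i = 0 then (if j = 0 then 1 else 0)
  else (2 : ℝ) ^ (-(i : ℝ) - (j : ℝ)) * (Nat.factorial (i + j - 1)) /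
    ((Nat.factorial (i - 1)) * (Nat.factorial j))

/-- `Y` is a Markov chain with transition probabilities `trans` started at `k`:
`P(Y_0 = k) = 1` and
`P(Y_0 = k_0, …, Y_n = k_n) = P(Y_0 = k_0) · ∏_{0 ≤ i < n} trans(k_i, k_{i+1})`. -/
def IsMarkovChainFrom {Ω : Type*} [MeasurableSpace Ω] (P : Measure Ω)
    (Y : ℕ → Ω → ℕ) (trans : ℕ → ℕ → ℝ) (k : ℕ) : Prop :=
  (∀ t, Measurable (Y t)) ∧
    ∀ (n : ℕ) (ks : ℕ → ℕ),
      P {ω | ∀ i ≤ n, Y i ω = ks i} =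
        ENNReal.ofReal ((if ks 0 = k then 1 else 0) *
          ∏ i ∈ Finset.range n, trans (ks i) (ks (i + 1)))

/-- `Ỹ_t := Y_t + Y_{t−1}`. -/
def Ytil {Ω : Type*} (Y : ℕ → Ω → ℕ) (t : ℕ) (ω : Ω) : ℕ :=
  Y t ω + Y (t - 1) ω

/-- `σ̃_h := inf{t ≥ 1 : Ỹ_t ≥ h}` (with value `∞` if there is no such `t`). -/
noncomputable def sigmaTil {Ω : Type*} (Y : ℕ → Ω → ℕ) (h : ℕ) (ω : Ω) : ℕ∞ :=
  sInf ((↑) '' {t : ℕ | 1 ≤ t ∧ h ≤ Ytil Y t ω} : Set ℕ∞)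

lemma HasSum.of_eq {f g : ℕ → ℝ} {a b : ℝ} (h : HasSum f a) (hfg : ∀ j, g j = f j) (hab : b = a) :
    HasSum g b := by
  rwa [funext hfg, hab]

lemma piGW_zero_left (j : ℕ) : piGW 0 j = if j = 0 then 1 else 0 := by
  simp [piGW]

lemma piGW_succ (m j : ℕ) :
    piGW (m + 1) j = (1 / 2) ^ (m + 1) * ((j + m).choose m * (1 / 2) ^ j) := by
  have e : (2 : ℝ) ^ (-((m + 1 : ℕ) : ℝ) - (j : ℝ)) = (1 / 2) ^ (m + 1) * (1 / 2) ^ j := by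
    rw [Real.rpow_sub two_pos, Real.rpow_neg two_pos.le, Real.rpow_natCast, Real.rpow_natCast]
    simp [div_eq_mul_inv]
  have f : m + 1 + j - 1 = j + m := by omega
  rw [piGW, if_neg (by omega), e, f, Nat.add_choose, Nat.cast_div
    (Nat.factorial_mul_factorial_dvd_factorial_add j m) (by positivity)]
  push_cast
  field_simp

lemma piGW_nonneg (i j : ℕ) : 0 ≤ piGW i j := by
  unfold piGW
  positivity

lemma piGW_zero_right {i : ℕ} (hi : 0 < i) : piGW i 0 = (1 / 2) ^ i := by
  obtain ⟨m, rfl⟩ := Nat.exists_eq_succ_of_ne_zero hi.ne'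
  simp [piGW_succ]

/-- Generating function of the offspring of `i` individuals. -/
lemma hasSum_piGW_mul_pow {i : ℕ} (hi : 0 < i) {z : ℝ} (hz : 0 ≤ z) (hz2 : z < 2) :
    HasSum (fun j => piGW i j * z ^ j) (((2 - z)⁻¹) ^ i) := by
  obtain ⟨m, rfl⟩ := Nat.exists_eq_succ_of_ne_zero hi.ne'
  have hn : ‖z / 2‖ < 1 := by
    rw [Real.norm_eq_abs, abs_of_nonneg (by positivity)]
    linarith
  refine ((hasSum_choose_mul_geometric_of_norm_lt_one m hn).mul_left
    ((1 / 2 : ℝ) ^ (m + 1))).of_eq (fun j => ?_) ?_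
  · rw [Nat.succ_eq_add_one, piGW_succ, show z / 2 = 1 / 2 * z by ring, mul_pow]
    ring
  · have : (2 - z) ≠ 0 := by linarith
    have : (1 - z / 2) ≠ 0 := by linarith
    rw [Nat.succ_eq_add_one, ← one_div_pow, ← mul_pow]
    congr 1
    field_simp

lemma hasSum_piGW {i : ℕ} (hi : 0 < i) : HasSum (piGW i) 1 := by
  have h := hasSum_piGW_mul_pow hi zero_le_one one_lt_two
  norm_num at h
  exact h

lemma piGW_succ_right_mul (m j : ℕ) :
    piGW (m + 1) (j + 1) * ((j : ℝ) + 1) = (m + 1) * piGW (m + 2) j := by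
  rw [piGW_succ, piGW_succ]
  have h : (j + 1 + m).choose m * (j + 1) = (m + 1) * (j + (m + 1)).choose (m + 1) := by
    have h := Nat.choose_succ_right_eq (j + 1 + m) m
    rw [show j + (m + 1) = j + 1 + m by ring, mul_comm (m + 1), h]
    congr 1
    omega
  have h' : ((j + 1 + m).choose m : ℝ) * (j + 1) = (m + 1) * (j + (m + 1)).choose (m + 1) := by
    exact_mod_cast h
  calc _ = (1 / 2 : ℝ) ^ (m + 1) * (1 / 2) ^ (j + 1) * (((j + 1 + m).choose m : ℝ) * (j + 1)) := by
        ring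
    _ = _ := by rw [h']; ring

lemma hasSum_piGW_mul {i : ℕ} (hi : 0 < i) : HasSum (fun j => piGW i j * (j : ℝ)) i := by
  obtain ⟨m, rfl⟩ := Nat.exists_eq_succ_of_ne_zero hi.ne'
  rw [← hasSum_nat_add_iff' 1]
  refine ((hasSum_piGW (i := m + 2) (by omega)).mul_left ((m : ℝ) + 1)).of_eq (fun j => ?_) ?_
  · rw [← piGW_succ_right_mul]
    push_cast
    rfl
  · simp

lemma hasSum_piGW_mul_descFactorial {i : ℕ} (hi : 0 < i) :
    HasSum (fun j => piGW i j * ((j : ℝ) * (j - 1))) ((i : ℝ) * (i + 1)) := by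
  obtain ⟨m, rfl⟩ := Nat.exists_eq_succ_of_ne_zero hi.ne'
  rw [← hasSum_nat_add_iff' 1]
  refine ((hasSum_piGW_mul (i := m + 2) (by omega)).mul_left ((m : ℝ) + 1)).of_eq
    (fun j => ?_) ?_
  · rw [← mul_assoc ((m : ℝ) + 1), ← piGW_succ_right_mul]
    push_cast
    rw [Nat.succ_eq_add_one]
    ring
  · push_cast
    simp only [Finset.sum_range_one, Nat.cast_zero, zero_mul, mul_zero, sub_zero]
    ring

lemma hasSum_piGW_mul_sq_sub {i : ℕ} (hi : 0 < i) :
    HasSum (fun j => piGW i j * ((i : ℝ) - j) ^ 2) (2 * i) := by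
  refine (((hasSum_piGW_mul_descFactorial hi).add
    ((hasSum_piGW_mul hi).mul_left (1 - 2 * (i : ℝ)))).add
    ((hasSum_piGW hi).mul_left ((i : ℝ) ^ 2))).of_eq (fun j => ?_) ?_
  · ring
  · ring

/-- Probability that the chain started at `i` satisfies `Y_t + Y_{t-1} < h` for `1 ≤ t ≤ n`. -/
noncomputable def stayProb (h : ℕ) : ℕ → ℕ → ℝ
  | 0, _ => 1
  | n + 1, i => ∑ j ∈ Finset.range (h - i), piGW i j * stayProb h n j

lemma stayProb_nonneg (h n i : ℕ) : 0 ≤ stayProb h n i := by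
  induction n generalizing i with
  | zero => simp [stayProb]
  | succ n ih => exact Finset.sum_nonneg fun j _ => mul_nonneg (piGW_nonneg i j) (ih j)

/-- A function that is superharmonic for the killed chain and at least `1` at `0` dominates
the probability of staying, up to the exponentially small probability of staying alive. -/
lemma stayProb_le {h : ℕ} (hh : 0 < h) (g : ℕ → ℝ) (g0 : 1 ≤ g 0) (gpos : ∀ i, 0 ≤ g i)
    (hg : ∀ i, 0 < i → i < h → ∑ j ∈ Finset.range (h - i), piGW i j * g j ≤ g i) (n i : ℕ) :
    stayProb h n i ≤ g i + if i = 0 then 0 else (1 - (1 / 2 : ℝ) ^ h) ^ n := by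
  have hρ : (0 : ℝ) ≤ 1 - (1 / 2 : ℝ) ^ h :=
    sub_nonneg.2 (pow_le_one₀ (by norm_num) (by norm_num))
  induction n generalizing i with
  | zero =>
    rcases Nat.eq_zero_or_pos i with rfl | hi
    · simpa [stayProb] using g0
    · simpa [stayProb, hi.ne'] using gpos i
  | succ n ih =>
    rcases Nat.eq_zero_or_pos i with rfl | hi
    · simpa [stayProb, piGW_zero_left, hh] using ih 0
    rw [if_neg hi.ne']
    rcases le_or_gt h i with hih | hih
    · have : stayProb h (n + 1) i = 0 := by simp [stayProb, Nat.sub_eq_zero_of_le hih]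
      rw [this]
      exact add_nonneg (gpos i) (pow_nonneg hρ _)
    set ρ := 1 - (1 / 2 : ℝ) ^ h with hρdef
    have alive : ∑ j ∈ Finset.range (h - i), piGW i j * (if j = 0 then 0 else ρ ^ n) ≤
        ρ ^ (n + 1) := by
      obtain ⟨l, hl⟩ := Nat.exists_eq_succ_of_ne_zero (Nat.sub_pos_of_lt hih).ne'
      have tot := (hasSum_piGW hi).summable.sum_le_tsum (Finset.range (l + 1))
        (fun j _ => piGW_nonneg i j)
      rw [(hasSum_piGW hi).tsum_eq, Finset.sum_range_succ', piGW_zero_right hi] at tot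
      have hp : (1 / 2 : ℝ) ^ h ≤ (1 / 2) ^ i :=
        pow_le_pow_of_le_one (by norm_num) (by norm_num) hih.le
      rw [hl, Finset.sum_range_succ']
      simp only [Nat.add_eq_zero_iff, one_ne_zero, and_false, if_false, if_true, mul_zero,
        add_zero]
      rw [← Finset.sum_mul, pow_succ']
      exact mul_le_mul_of_nonneg_right (by linarith) (pow_nonneg hρ n)
    calc stayProb h (n + 1) i
        ≤ ∑ j ∈ Finset.range (h - i), piGW i j * (g j + if j = 0 then 0 else ρ ^ n) :=
          Finset.sum_le_sum fun j _ => mul_le_mul_of_nonneg_left (ih j) (piGW_nonneg i j)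
      _ = ∑ j ∈ Finset.range (h - i), piGW i j * g j +
          ∑ j ∈ Finset.range (h - i), piGW i j * (if j = 0 then 0 else ρ ^ n) := by
          simp_rw [mul_add, Finset.sum_add_distrib]
      _ ≤ _ := add_le_add (hg i hi hih) alive

section Chain

variable {Ω : Type*} [MeasurableSpace Ω] {P : Measure Ω} {Y : ℕ → Ω → ℕ} {k : ℕ}

lemma measure_prefix_stay_le (hY : IsMarkovChainFrom P Y piGW k) (h n m : ℕ) (ks : ℕ → ℕ) :
    P {ω | (∀ i ≤ m, Y i ω = ks i) ∧ ∀ t, m ≤ t → t < m + n → Y (t + 1) ω + Y t ω < h} ≤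
      ENNReal.ofReal (((if ks 0 = k then 1 else 0) *
        ∏ i ∈ Finset.range m, piGW (ks i) (ks (i + 1))) * stayProb h n (ks m)) := by
  induction n generalizing m ks with
  | zero =>
    rw [stayProb, mul_one, ← hY.2 m ks]
    exact measure_mono fun ω hω => hω.1
  | succ n ih =>
    set p : ℝ := (if ks 0 = k then 1 else 0) *
        ∏ i ∈ Finset.range m, piGW (ks i) (ks (i + 1)) with hp
    have hp0 : 0 ≤ p := mul_nonneg (by positivity) (Finset.prod_nonneg fun i _ => piGW_nonneg _ _)
    have hsub : {ω | (∀ i ≤ m, Y i ω = ks i) ∧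
          ∀ t, m ≤ t → t < m + (n + 1) → Y (t + 1) ω + Y t ω < h} ⊆
        ⋃ j ∈ Finset.range (h - ks m), {ω | (∀ i ≤ m + 1, Y i ω = Function.update ks (m + 1) j i) ∧
          ∀ t, m + 1 ≤ t → t < m + 1 + n → Y (t + 1) ω + Y t ω < h} := by
      rintro ω ⟨h1, h2⟩
      simp only [Set.mem_iUnion, Finset.mem_range, Set.mem_ofPred_eq]
      refine ⟨Y (m + 1) ω, ?_, fun i hi => ?_, fun t ht ht' => h2 t (by omega) (by omega)⟩
      · have := h2 m le_rfl (by omega)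
        rw [h1 m le_rfl] at this
        omega
      · rcases Nat.lt_or_ge m i with hlt | hle
        · obtain rfl : i = m + 1 := by omega
          simp
        · rw [Function.update_of_ne (by omega)]
          exact h1 i hle
    refine (measure_mono hsub).trans ((measure_biUnion_finset_le _ _).trans ?_)
    have hterm : ∀ j, P {ω | (∀ i ≤ m + 1, Y i ω = Function.update ks (m + 1) j i) ∧
          ∀ t, m + 1 ≤ t → t < m + 1 + n → Y (t + 1) ω + Y t ω < h} ≤
        ENNReal.ofReal (p * (piGW (ks m) j * stayProb h n j)) := by
      intro j
      refine (ih (m + 1) (Function.update ks (m + 1) j)).trans (le_of_eq ?_)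
      congr 1
      rw [Finset.prod_range_succ, Function.update_self, Function.update_of_ne (by omega),
        Function.update_of_ne (by omega), Finset.prod_congr rfl (g := fun i =>
          piGW (ks i) (ks (i + 1))), hp]
      · ring
      · intro i hi
        have := Finset.mem_range.1 hi
        rw [Function.update_of_ne (by omega), Function.update_of_ne (by omega)]
    refine (Finset.sum_le_sum fun j _ => hterm j).trans (le_of_eq ?_)
    rw [← ENNReal.ofReal_sum_of_nonneg fun j _ => mul_nonneg hp0
      (mul_nonneg (piGW_nonneg _ _) (stayProb_nonneg _ _ _)), stayProb, Finset.mul_sum]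

lemma measure_sigmaTil_eq_top_le [IsProbabilityMeasure P] (hY : IsMarkovChainFrom P Y piGW k)
    (h n : ℕ) : P {ω | sigmaTil Y h ω = ⊤} ≤ ENNReal.ofReal (stayProb h n k) := by
  have hone : P {ω | ∀ i ≤ 0, Y i ω = k} = 1 := by
    simpa using hY.2 0 fun _ => k
  have hmeas : MeasurableSet {ω | ∀ i ≤ 0, Y i ω = k} := by
    have : {ω | ∀ i ≤ 0, Y i ω = k} = Y 0 ⁻¹' {k} := by
      ext ω
      simp
    rw [this]
    exact hY.1 0 (measurableSet_singleton k)
  rw [← measure_inter_conull ((prob_compl_eq_zero_iff hmeas).2 hone)]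
  refine (measure_mono ?_).trans ((measure_prefix_stay_le hY h n 0 fun _ => k).trans (by simp))
  rintro ω ⟨hσ, hk⟩
  refine ⟨hk, fun t _ _ => ?_⟩
  by_contra! hge
  have : sigmaTil Y h ω ≤ ((t + 1 : ℕ) : ℕ∞) :=
    sInf_le ⟨t + 1, ⟨by omega, by simpa [Ytil] using hge⟩, rfl⟩
  rw [show sigmaTil Y h ω = ⊤ from hσ] at this
  exact absurd (top_le_iff.1 this) (ENat.natCast_ne_top _)

end Chain

/-- Concave part of the dominating function; `r` is the square root of the level. -/
noncomputable def profile (r x : ℝ) : ℝ :=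
  r ^ 2 / 2 - x + 11 * r - r * Real.exp (x / r - r / 2 - 8)

/-- `2 / r ^ 2` times this function dominates the probability of never reaching level `r ^ 2`. -/
noncomputable def barrier (r x : ℝ) : ℝ :=
  if x ≤ r ^ 2 / 2 + 8 * r then profile r x else 2 * r

lemma two_mul_le_profile {r x : ℝ} (hr : 0 < r) (hx : x ≤ r ^ 2 / 2 + 8 * r) :
    2 * r ≤ profile r x := by
  have hy : x / r - r / 2 - 8 ≤ 0 := by
    have : x / r ≤ r / 2 + 8 := by
      rw [div_le_iff₀ hr]
      nlinarith
    linarith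
  have := mul_le_mul_of_nonneg_left (Real.exp_le_one_iff.2 hy) hr.le
  unfold profile
  linarith

lemma two_mul_le_barrier {r : ℝ} (hr : 0 < r) (x : ℝ) : 2 * r ≤ barrier r x := by
  unfold barrier
  split_ifs with h
  · exact two_mul_le_profile hr h
  · exact le_rfl

lemma barrier_le {r : ℝ} (hr : 0 < r) (x : ℝ) :
    barrier r x ≤ max (r ^ 2 / 2 - x) 0 + 11 * r := by
  unfold barrier profile
  split_ifs with h
  · have := mul_pos hr (Real.exp_pos (x / r - r / 2 - 8))
    linarith [le_max_left (r ^ 2 / 2 - x) 0]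
  · linarith [le_max_right (r ^ 2 / 2 - x) 0]

lemma barrier_le_profile_add {r : ℝ} (hr : 0 < r) (x : ℝ) :
    barrier r x ≤ profile r x + 2 * r * Real.exp (2 * (x / r - r / 2 - 8)) := by
  unfold barrier
  split_ifs with h
  · exact le_add_of_nonneg_right (by positivity)
  · set t := x / r - r / 2 - 8 with ht
    have hx : x = r * (t + r / 2 + 8) := by
      rw [ht]
      field_simp
      ring
    have ht0 : 0 ≤ t := by
      rw [hx] at h
      nlinarith
    have h1 := Real.add_one_le_exp t
    have h2 : Real.exp (2 * t) = Real.exp t ^ 2 := by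
      rw [← Real.exp_nat_mul]
      norm_num
    have key : 0 ≤ 1 - t - Real.exp t + 2 * Real.exp t ^ 2 := by nlinarith
    have hp : profile r x = r * (3 - t - Real.exp t) := by
      rw [profile, ← ht, hx]
      ring
    rw [hp, h2]
    nlinarith

/-- Lower bound for the exponential moment. -/
lemma exp_mul_le_inv_two_sub_exp_pow {a : ℝ} (ha : 0 ≤ a) (ha1 : Real.exp a < 2) (i : ℕ) :
    Real.exp (i * a) * (1 + i * a ^ 2) ≤ ((2 - Real.exp a)⁻¹) ^ i := by
  have h1 : Real.exp a * (1 + a ^ 2) ≤ (2 - Real.exp a)⁻¹ := by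
    rw [← one_div, le_div_iff₀ (by linarith)]
    nlinarith [Real.add_one_le_exp a, sq_nonneg a, mul_nonneg ha
      (sub_nonneg.2 (Real.add_one_le_exp a))]
  calc Real.exp (i * a) * (1 + i * a ^ 2) ≤ Real.exp a ^ i * (1 + a ^ 2) ^ i := by
        rw [Real.exp_nat_mul]
        exact mul_le_mul_of_nonneg_left
          (one_add_mul_le_pow (by nlinarith [sq_nonneg a]) i) (by positivity)
    _ = (Real.exp a * (1 + a ^ 2)) ^ i := (mul_pow _ _ _).symm
    _ ≤ _ := pow_le_pow_left₀ (by positivity) h1 i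

lemma exp_two_mul_sub_one_le {a : ℝ} (ha : 0 ≤ a) (ha1 : a ≤ 1 / 100) :
    Real.exp (2 * a) - 1 ≤ 2.1 * a := by
  have := (abs_le.1 (Real.abs_exp_sub_one_sub_id_le (x := 2 * a)
    (by rw [abs_of_nonneg (by linarith)]; linarith))).2
  nlinarith

/-- Upper bound for the exponential moment. -/
lemma inv_two_sub_exp_pow_le {a : ℝ} (ha : 0 ≤ a) (ha1 : a ≤ 1 / 100) (i : ℕ) :
    ((2 - Real.exp (2 * a))⁻¹) ^ i ≤ Real.exp (i * (2 * a + 5 * a ^ 2)) := by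
  have he := exp_two_mul_sub_one_le ha ha1
  have he0 := Real.add_one_le_exp (2 * a)
  have h1 : (2 - Real.exp (2 * a))⁻¹ ≤ Real.exp (2 * a + 5 * a ^ 2) := by
    rw [← one_div, div_le_iff₀ (by linarith), Real.exp_add]
    have h5 := Real.add_one_le_exp (5 * a ^ 2)
    have h2 : 1 - 4.41 * a ^ 2 ≤ Real.exp (2 * a) * (2 - Real.exp (2 * a)) := by nlinarith
    have h3 : 1 ≤ (1 - 4.41 * a ^ 2) * (5 * a ^ 2 + 1) := by
      have : a ^ 2 ≤ 1 / 10000 := by nlinarith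
      nlinarith [sq_nonneg a]
    have h4 : (0 : ℝ) ≤ 1 - 4.41 * a ^ 2 := by nlinarith
    calc (1 : ℝ) ≤ (1 - 4.41 * a ^ 2) * (5 * a ^ 2 + 1) := h3
      _ ≤ (Real.exp (2 * a) * (2 - Real.exp (2 * a))) * Real.exp (5 * a ^ 2) :=
        mul_le_mul h2 h5 (by positivity) (h4.trans h2)
      _ = _ := by ring
  rw [Real.exp_nat_mul]
  exact pow_le_pow_left₀ (inv_nonneg.2 (by linarith)) h1 i

/-- The gain from concavity exceeds the overshoot term. -/
lemma exp_overshoot_le {r x : ℝ} (hr : 0 < r) (hx : 1 ≤ x) (hx2 : x ≤ r ^ 2 / 2 + 2 * r) :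
    2 * Real.exp (x / r - r / 2 - 5) ≤ x / r ^ 2 := by
  have hr2 : 0 < r ^ 2 := by positivity
  have e1 : (2.7 : ℝ) ≤ Real.exp 1 := by linarith [Real.exp_one_gt_d9]
  have e3 : (16 : ℝ) ≤ Real.exp 3 := by
    have : Real.exp 3 = Real.exp 1 ^ 3 := by
      rw [← Real.exp_nat_mul]
      norm_num
    rw [this]
    calc (16 : ℝ) ≤ 2.7 ^ 3 := by norm_num
      _ ≤ _ := by gcongr
  rcases le_or_gt (r ^ 2 / 4) x with h | h
  · have hy : x / r - r / 2 - 5 ≤ -3 := by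
      have : x / r ≤ r / 2 + 2 := by
        rw [div_le_iff₀ hr]
        nlinarith
      linarith
    have h1 : Real.exp (x / r - r / 2 - 5) ≤ 1 / 16 := by
      refine (Real.exp_le_exp.2 hy).trans ?_
      rw [Real.exp_neg, ← one_div]
      exact one_div_le_one_div_of_le (by norm_num) e3
    have : 1 / 4 ≤ x / r ^ 2 := by
      rw [le_div_iff₀ hr2]
      linarith
    linarith
  · have hy : x / r - r / 2 - 5 ≤ -(r / 4 + 5) := by
      have : x / r ≤ r / 4 := by
        rw [div_le_iff₀ hr]
        nlinarith
      linarith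
    have e5 : (64 : ℝ) ≤ Real.exp 5 := by
      have : Real.exp 5 = Real.exp 1 ^ 5 := by
        rw [← Real.exp_nat_mul]
        norm_num
      rw [this]
      calc (64 : ℝ) ≤ 2.7 ^ 5 := by norm_num
        _ ≤ _ := by gcongr
    have hq : r ^ 2 / 32 ≤ Real.exp (r / 4) := by
      have := Real.quadratic_le_exp_of_nonneg (x := r / 4) (by positivity)
      nlinarith
    have h2 : 2 * r ^ 2 ≤ Real.exp (r / 4 + 5) := by
      rw [Real.exp_add]
      calc 2 * r ^ 2 = r ^ 2 / 32 * 64 := by ring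
        _ ≤ _ := by gcongr
    have h3 : Real.exp (x / r - r / 2 - 5) ≤ 1 / (2 * r ^ 2) := by
      refine (Real.exp_le_exp.2 hy).trans ?_
      rw [Real.exp_neg, ← one_div]
      exact one_div_le_one_div_of_le (by positivity) h2
    calc 2 * Real.exp (x / r - r / 2 - 5) ≤ 2 * (1 / (2 * r ^ 2)) := by gcongr
      _ = 1 / r ^ 2 := by field_simp
      _ ≤ x / r ^ 2 := by gcongr

lemma sum_barrier_le_of_le {r : ℝ} (hr : 100 ≤ r) {i : ℕ} (hi : 0 < i)
    (hir : (i : ℝ) ≤ r ^ 2 / 2 + 2 * r) (s : Finset ℕ) :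
    ∑ j ∈ s, piGW i j * barrier r j ≤ barrier r i := by
  have hr0 : 0 < r := by linarith
  set a := 1 / r with ha
  have ha0 : 0 ≤ a := by positivity
  have ha1 : a ≤ 1 / 100 := one_div_le_one_div_of_le (by norm_num) hr
  have he2 : Real.exp (2 * a) < 2 := by linarith [exp_two_mul_sub_one_le ha0 ha1]
  have he1 : Real.exp a < 2 := (Real.exp_le_exp.2 (by linarith)).trans_lt he2
  set c := Real.exp (-(r / 2) - 8) with hc
  have hsum := ((((hasSum_piGW hi).mul_left (r ^ 2 / 2 + 11 * r)).sub (hasSum_piGW_mul hi)).sub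
    ((hasSum_piGW_mul_pow hi (Real.exp_pos a).le he1).mul_left (r * c))).add
    ((hasSum_piGW_mul_pow hi (Real.exp_pos (2 * a)).le he2).mul_left (2 * r * c ^ 2))
  have hterm : ∀ j : ℕ, piGW i j *
      (profile r j + 2 * r * Real.exp (2 * ((j : ℝ) / r - r / 2 - 8))) =
      (r ^ 2 / 2 + 11 * r) * piGW i j - piGW i j * j - r * c * (piGW i j * Real.exp a ^ j) +
        2 * r * c ^ 2 * (piGW i j * Real.exp (2 * a) ^ j) := by
    intro j
    have h1 : Real.exp ((j : ℝ) / r - r / 2 - 8) = c * Real.exp a ^ j := by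
      rw [hc, ← Real.exp_nat_mul, ← Real.exp_add, ha]
      congr 1
      ring
    have h2 : Real.exp (2 * ((j : ℝ) / r - r / 2 - 8)) = c ^ 2 * Real.exp (2 * a) ^ j := by
      rw [hc, ← Real.exp_nat_mul, ← Real.exp_nat_mul, ← Real.exp_add, ha]
      congr 1
      push_cast
      ring
    rw [profile, h1, h2]
    ring
  have hsum' := hsum.of_eq hterm rfl
  have hle : ∀ j : ℕ, piGW i j * barrier r j ≤ piGW i j *
      (profile r j + 2 * r * Real.exp (2 * ((j : ℝ) / r - r / 2 - 8))) := fun j =>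
    mul_le_mul_of_nonneg_left (barrier_le_profile_add hr0 j) (piGW_nonneg i j)
  have hnn : ∀ j : ℕ, 0 ≤ piGW i j * barrier r j := fun j =>
    mul_nonneg (piGW_nonneg i j) (by linarith [two_mul_le_barrier hr0 (j : ℝ)])
  refine (Finset.sum_le_sum fun j _ => hle j).trans ((sum_le_hasSum s
    (fun j _ => (hnn j).trans (hle j)) hsum').trans ?_)
  have hbi : barrier r i = profile r i := if_pos (by linarith)
  have hpi : profile r i = r ^ 2 / 2 + 11 * r - i - r * c * Real.exp (i * a) := by
    have h1 : Real.exp ((i : ℝ) / r - r / 2 - 8) = c * Real.exp (i * a) := by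
      rw [hc, ← Real.exp_add, ha]
      congr 1
      ring
    rw [profile, h1]
    ring
  have hlow := exp_mul_le_inv_two_sub_exp_pow ha0 he1 i
  have hia : (i : ℝ) * a ^ 2 = i / r ^ 2 := by
    rw [ha]
    field_simp
  have hia' : (i : ℝ) * a ^ 2 ≤ 0.6 := by
    rw [hia, div_le_iff₀ (by positivity)]
    nlinarith
  have hup : ((2 - Real.exp (2 * a))⁻¹) ^ i ≤ Real.exp (i * a) * Real.exp (i * a + 3) := by
    refine (inv_two_sub_exp_pow_le ha0 ha1 i).trans ?_
    rw [← Real.exp_add]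
    exact Real.exp_le_exp.2 (by nlinarith)
  have hov : 2 * (c * Real.exp (i * a + 3)) ≤ i * a ^ 2 := by
    have : c * Real.exp (i * a + 3) = Real.exp ((i : ℝ) / r - r / 2 - 5) := by
      rw [hc, ← Real.exp_add, ha]
      congr 1
      ring
    rw [this, hia]
    exact exp_overshoot_le hr0 (by exact_mod_cast hi) hir
  have hc0 : 0 < c := Real.exp_pos _
  have h1 : r * c * (Real.exp (i * a) * (1 + i * a ^ 2)) ≤
      r * c * ((2 - Real.exp a)⁻¹) ^ i := by gcongr
  have h2 : 2 * r * c ^ 2 * ((2 - Real.exp (2 * a))⁻¹) ^ i ≤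
      2 * r * c ^ 2 * (Real.exp (i * a) * Real.exp (i * a + 3)) := by gcongr
  have h3 : r * c * Real.exp (i * a) * (2 * (c * Real.exp (i * a + 3))) ≤
      r * c * Real.exp (i * a) * (i * a ^ 2) := by gcongr
  rw [hbi, hpi]
  linarith

lemma sum_barrier_le_of_ge {r : ℝ} (hr : 0 < r) {h i : ℕ} (hh : (h : ℝ) = r ^ 2) (hi : 0 < i)
    (hih : i < h) (hir : r ^ 2 / 2 + 2 * r < i) :
    ∑ j ∈ Finset.range (h - i), piGW i j * barrier r j ≤ barrier r i := by
  refine le_trans ?_ (two_mul_le_barrier hr i)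
  have hle : ∀ j ∈ Finset.range (h - i),
      piGW i j * barrier r j ≤ 15 / (16 * r) * (piGW i j * ((i : ℝ) - j) ^ 2) := by
    intro j hj
    have hj' : (j : ℝ) + i < r ^ 2 := by
      rw [← hh]
      have := Finset.mem_range.1 hj
      exact_mod_cast (show j + i < h by omega)
    have hd : 4 * r ≤ (i : ℝ) - j := by linarith
    have hb : barrier r j ≤ ((i : ℝ) - j) + 11 * r := by
      refine (barrier_le hr j).trans (add_le_add_left (max_le ?_ ?_) _) <;> linarith
    have hb' : barrier r j ≤ 15 / (16 * r) * ((i : ℝ) - j) ^ 2 := by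
      refine hb.trans ?_
      rw [div_mul_eq_mul_div, le_div_iff₀ (by positivity)]
      nlinarith [mul_nonneg (sub_nonneg.2 hd) (sub_nonneg.2 hd)]
    calc _ ≤ piGW i j * (15 / (16 * r) * ((i : ℝ) - j) ^ 2) :=
          mul_le_mul_of_nonneg_left hb' (piGW_nonneg i j)
      _ = _ := by ring
  refine (Finset.sum_le_sum hle).trans ?_
  have hs := (hasSum_piGW_mul_sq_sub hi).mul_left (15 / (16 * r))
  refine (sum_le_hasSum _ (fun j _ => ?_) hs).trans ?_
  · have := piGW_nonneg i j
    positivity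
  · have : (i : ℝ) ≤ r ^ 2 := by
      rw [← hh]
      exact_mod_cast hih.le
    rw [div_mul_eq_mul_div, div_le_iff₀ (by positivity)]
    nlinarith

lemma stayProb_le_barrier {h : ℕ} (hh : 10000 ≤ h) (n k : ℕ) :
    stayProb h n k ≤ 2 / h * (max ((h : ℝ) / 2 - k) 0 + 11 * √h) + (1 - (1 / 2 : ℝ) ^ h) ^ n := by
  set r := √(h : ℝ) with hrdef
  have hr2 : (h : ℝ) = r ^ 2 := (Real.sq_sqrt (Nat.cast_nonneg h)).symm
  have hr : 100 ≤ r := Real.le_sqrt_of_sq_le (by norm_num; exact_mod_cast hh)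
  have hr0 : 0 < r := by linarith
  have hρ : (0 : ℝ) ≤ 1 - (1 / 2 : ℝ) ^ h :=
    sub_nonneg.2 (pow_le_one₀ (by norm_num) (by norm_num))
  have hpos : ∀ x, 0 ≤ barrier r x := fun x => by linarith [two_mul_le_barrier hr0 x]
  have main := stayProb_le (h := h) (by omega) (fun i => 2 / r ^ 2 * barrier r i) ?_
    (fun i => mul_nonneg (by positivity) (hpos i)) ?_ n k
  · have hb : 2 / r ^ 2 * barrier r k ≤ 2 / r ^ 2 * (max (r ^ 2 / 2 - k) 0 + 11 * r) :=
      mul_le_mul_of_nonneg_left (barrier_le hr0 k) (by positivity)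
    rw [hr2]
    refine main.trans (add_le_add hb ?_)
    split_ifs
    · exact pow_nonneg hρ n
    · exact le_rfl
  · have : r ^ 2 / 2 ≤ barrier r (0 : ℕ) := by
      have he : Real.exp (((0 : ℕ) : ℝ) / r - r / 2 - 8) ≤ 1 := by
        rw [Real.exp_le_one_iff]
        simp
        linarith
      rw [barrier, if_pos (by push_cast; positivity), profile]
      push_cast at he ⊢
      nlinarith
    calc (1 : ℝ) = 2 / r ^ 2 * (r ^ 2 / 2) := by field_simp
      _ ≤ _ := mul_le_mul_of_nonneg_left this (by positivity)
  · intro i hi hih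
    have key : ∑ j ∈ Finset.range (h - i), piGW i j * barrier r j ≤ barrier r i := by
      rcases le_or_gt (i : ℝ) (r ^ 2 / 2 + 2 * r) with hir | hir
      · exact sum_barrier_le_of_le hr hi hir _
      · exact sum_barrier_le_of_ge hr0 hr2 hi hih hir
    calc _ = 2 / r ^ 2 * ∑ j ∈ Finset.range (h - i), piGW i j * barrier r j := by
          rw [Finset.mul_sum]
          exact Finset.sum_congr rfl fun j _ => by ring
      _ ≤ _ := mul_le_mul_of_nonneg_left key (by positivity)

/-- For every ε > 0 there exists a finite constant C such that for every
integer h ≥ 1 and every integer k ∈ [(h − h^{1/2+ε})/2, (h + h^{1/2+ε})/2],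
if the chain Y starts at k then P(σ̃_h = ∞) < C·h^{−1/2+ε}. -/
theorem stmt_9 :
    ∀ ε : ℝ, 0 < ε → ∃ C : ℝ,
      ∀ (h k : ℕ), 1 ≤ h →
        ((h : ℝ) - (h : ℝ) ^ ((1 : ℝ) / 2 + ε)) / 2 ≤ (k : ℝ) →
        (k : ℝ) ≤ ((h : ℝ) + (h : ℝ) ^ ((1 : ℝ) / 2 + ε)) / 2 →
        ∀ (Ω : Type) (_ : MeasurableSpace Ω) (P : Measure Ω) (Y : ℕ → Ω → ℕ),
          IsProbabilityMeasure P → IsMarkovChainFrom P Y piGW k →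
          P {ω | sigmaTil Y h ω = ⊤} <
            ENNReal.ofReal (C * (h : ℝ) ^ (-(1 : ℝ) / 2 + ε)) := by
  intro ε hε
  refine ⟨101, fun h k hh hk _ Ω _ P Y hP hY => ?_⟩
  have hh1 : (1 : ℝ) ≤ h := by exact_mod_cast hh
  have hh0 : (0 : ℝ) < h := by linarith
  set r := √(h : ℝ) with hr
  have hr0 : 0 < r := Real.sqrt_pos.2 hh0
  have hr2 : (h : ℝ) = r ^ 2 := (Real.sq_sqrt hh0.le).symm
  set w := (h : ℝ) ^ (-(1 : ℝ) / 2 + ε) with hw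
  have hw0 : 0 < w := Real.rpow_pos_of_pos hh0 _
  have hrw : 1 / r ≤ w := by
    have : 1 / r = (h : ℝ) ^ (-(1 : ℝ) / 2) := by
      rw [hr, Real.sqrt_eq_rpow, neg_div, Real.rpow_neg hh0.le, one_div]
    rw [this]
    exact Real.rpow_le_rpow_of_exponent_le hh1 (by linarith)
  have hpow : (h : ℝ) ^ ((1 : ℝ) / 2 + ε) = h * w := by
    rw [hw, ← Real.rpow_one_add' hh0.le]
    · congr 1
      ring
    · linarith
  rcases lt_or_ge h 10000 with hsmall | hlarge
  · have hr100 : r < 100 := by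
      rw [hr, Real.sqrt_lt' (by norm_num)]
      norm_num
      exact_mod_cast hsmall
    have : 1 / 100 < w := (one_div_lt_one_div_of_lt hr0 hr100).trans_le hrw
    refine prob_le_one.trans_lt ?_
    rw [← ENNReal.ofReal_one]
    exact (ENNReal.ofReal_lt_ofReal_iff (by linarith)).2 (by linarith)
  · have hlt : 1 - (1 / 2 : ℝ) ^ h < 1 := sub_lt_self _ (by positivity)
    obtain ⟨n, hn⟩ := exists_pow_lt_of_lt_one hw0 hlt
    refine (measure_sigmaTil_eq_top_le hY h n).trans_lt
      ((ENNReal.ofReal_lt_ofReal_iff (by positivity)).2 ?_)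
    refine (stayProb_le_barrier hlarge n k).trans_lt ?_
    rw [hpow] at hk
    have hmax : max ((h : ℝ) / 2 - k) 0 ≤ h * w / 2 := max_le (by linarith) (by positivity)
    have hb : 2 / (h : ℝ) * (max ((h : ℝ) / 2 - k) 0 + 11 * r) ≤
        2 / (h : ℝ) * (h * w / 2 + 11 * r) := by gcongr
    have he : 2 / (h : ℝ) * (h * w / 2 + 11 * r) = w + 22 * (1 / r) := by
      rw [hr2]
      field_simp
      ring
    linarith
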